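/- Let w ∈ S∞, n a positive integer, φ a flag, and set t_i = min{n, φ(i)} for 1 ≤ i ≤ n. Then RFC_n(w,φ) = 𝔇_{t_1↓1} 𝔇_{t_2↓2} … 𝔇_{t_n↓n} RFC_n(w), where 𝔇_{b↓a} = 𝔇_{b−1}𝔇_{b−2}…𝔇_a for b > a and 𝔇_{a↓a} = id, with 𝔇_i the i-th Demazure operator on subsets of the Morse–Schilling crystal RF_n(w), and RFC_n(w) = RFC_n(w,standard flag). -/

import Mathlib

noncomputable section
attribute [local instance] Classical.propDecidable

/-! ### Words, permutations, reduced words -/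

/-- The adjacent transposition `s_i` exchanging `i` and `i+1`. -/
def sPerm (i : ℕ) : Equiv.Perm ℕ := Equiv.swap i (i + 1)

/-- The permutation `s_{i_1} ⋯ s_{i_n}` represented by the word `i_1 ⋯ i_n`. -/
def wordPerm (ρ : List ℕ) : Equiv.Perm ℕ := (ρ.map sPerm).prod

/-- A word whose letters are positive integers. -/
def PosWord (ρ : List ℕ) : Prop := ∀ x ∈ ρ, 1 ≤ x

/-- A reduced word: a word of positive integers of minimal length among all words of
positive integers representing the same permutation. -/
def IsReducedWord (ρ : List ℕ) : Prop :=
  PosWord ρ ∧ ∀ σ : List ℕ, PosWord σ → wordPerm σ = wordPerm ρ → ρ.length ≤ σ.length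

/-- `ρ` is a reduced word for the permutation `w`. -/
def IsReducedWordFor (w : Equiv.Perm ℕ) (ρ : List ℕ) : Prop :=
  IsReducedWord ρ ∧ wordPerm ρ = w

/-- A member of `S∞`: a permutation of the positive integers (it fixes `0`)
fixing all but finitely many points. -/
def FinitaryPerm (w : Equiv.Perm ℕ) : Prop := w 0 = 0 ∧ {i : ℕ | w i ≠ i}.Finite

/-- A flag: a weakly increasing function `φ : ℤ_{>0} → ℤ_{>0}` with `φ(n) ≥ n`. -/
def IsFlag (φ : ℕ → ℕ) : Prop :=
  (∀ m n : ℕ, 1 ≤ m → m ≤ n → φ m ≤ φ n) ∧ ∀ n : ℕ, 1 ≤ n → n ≤ φ n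

/-- A weak composition, as a function on the positive integers (value `0` at `0`)
with finitely many nonzero entries. -/
def WeakComp (α : ℕ → ℕ) : Prop := α 0 = 0 ∧ {i : ℕ | α i ≠ 0}.Finite

/-- `φ - e_i`, i.e. `l ↦ φ(l) - δ_{il}`. -/
def subE (φ : ℕ → ℕ) (i : ℕ) : ℕ → ℕ := fun l => if l = i then φ l - 1 else φ l

/-- The right action of `s_i` on weak compositions, swapping entries `i` and `i+1`. -/
def swapC (α : ℕ → ℕ) (i : ℕ) : ℕ → ℕ := fun j => α (sPerm i j)

/-- `α` has length `k`: `k` is minimal with `α i = 0` for all `i > k`. -/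
def HasLen (α : ℕ → ℕ) (k : ℕ) : Prop :=
  (∀ i, k < i → α i = 0) ∧ ∀ m, (∀ i, m < i → α i = 0) → k ≤ m

/-! ### Coxeter–Knuth equivalence -/

/-- One Coxeter–Knuth move. -/
def CKStep (u v : List ℕ) : Prop :=
  (∃ (a b : List ℕ) (x y z : ℕ), y < x ∧ x < z ∧
      u = a ++ [x, y, z] ++ b ∧ v = a ++ [x, z, y] ++ b) ∨
  (∃ (a b : List ℕ) (x y z : ℕ), y < z ∧ z < x ∧
      u = a ++ [x, y, z] ++ b ∧ v = a ++ [y, x, z] ++ b) ∨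
  (∃ (a b : List ℕ) (i : ℕ),
      u = a ++ [i, i + 1, i] ++ b ∧ v = a ++ [i + 1, i, i + 1] ++ b)

/-- Coxeter–Knuth equivalence: the transitive (symmetric, reflexive) closure of `CKStep`. -/
def CKEquiv : List ℕ → List ℕ → Prop := Relation.EqvGen CKStep

/-! ### Run factorizations and weak descent tableaux -/

/-- The run factorization of a word into maximal strictly increasing blocks
(listed from left to right). -/
def runFact : List ℕ → List (List ℕ)
  | [] => []
  | a :: rest =>
    match runFact rest with
    | [] => [[a]]
    | r :: rs => if a < r.headI then (a :: r) :: rs else [a] :: r :: rs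

/-- Auxiliary: rows of the remaining blocks, given the row of the previous block. -/
def wdtRowsAux : ℤ → List (List ℕ) → List ℤ
  | _, [] => []
  | prev, b :: bs =>
      min (prev - 1) (b.headI : ℤ) :: wdtRowsAux (min (prev - 1) (b.headI : ℤ)) bs

/-- The row indices assigned to the blocks of a run factorization (blocks listed
left to right): the leftmost block goes to the row indexed by its first letter, and each
subsequent block goes to the row indexed by its first letter if this is below the previous
block's row, and otherwise directly below the previous block's row. -/
def wdtRows : List (List ℕ) → List ℤ
  | [] => []
  | b :: bs => (b.headI : ℤ) :: wdtRowsAux (b.headI : ℤ) bs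

/-- A tableau: rows indexed by `ℤ` (bottom to top), columns indexed by `ℕ` starting at `1`;
the value `0` means that there is no box, a nonzero value is the (positive) entry. -/
abbrev Tableau := ℤ → ℕ → ℕ

/-- The weak descent tableau of a word. -/
def weakDesTab (ρ : List ℕ) : Tableau := fun r c =>
  if c = 0 then 0
  else
    match ((wdtRows (runFact ρ)).zip (runFact ρ)).find? (fun p => decide (p.1 = r)) with
    | some p => p.2.getD (c - 1) 0
    | none => 0

/-- A word is non-virtual if its weak descent tableau only occupies rows of positive index. -/
def NonVirtual (ρ : List ℕ) : Prop := ∀ r ∈ wdtRows (runFact ρ), 1 ≤ r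

/-- The shape of a tableau: the number of boxes in each (positively indexed) row. -/
def shapeOf (T : Tableau) : ℕ → ℕ := fun i => Set.ncard {c : ℕ | T (i : ℤ) c ≠ 0}

/-- The weak descent composition of a word: the shape of its weak descent tableau. -/
def desComp (ρ : List ℕ) : ℕ → ℕ := shapeOf (weakDesTab ρ)

/-- Partial-sum (dominance) order on weak compositions. -/
def compLE (μ ν : ℕ → ℕ) : Prop :=
  ∀ k : ℕ, ∑ i ∈ Finset.Icc 1 k, μ i ≤ ∑ i ∈ Finset.Icc 1 k, ν i

/-- A Yamanouchi reduced word: a non-virtual reduced word that is minimal in its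
Coxeter–Knuth class among non-virtual words, for the order
`ρ ≤ τ ↔ ρ ~ τ ∧ des ρ ≤ des τ`. -/
def Yamanouchi (ρ : List ℕ) : Prop :=
  IsReducedWord ρ ∧ NonVirtual ρ ∧
    ∀ σ : List ℕ, NonVirtual σ → CKEquiv ρ σ → compLE (desComp ρ) (desComp σ)

/-- The (unique) Yamanouchi reduced word Coxeter–Knuth equivalent to `ρ`. -/
def hatRho (ρ : List ℕ) : List ℕ :=
  if h : ∃ σ, Yamanouchi σ ∧ CKEquiv ρ σ then h.choose else []

/-- The weak Edelman–Greene insertion tableau of a word: the weak descent tableau of the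
unique Yamanouchi reduced word Coxeter–Knuth equivalent to it. -/
def hatP (ρ : List ℕ) : Tableau := weakDesTab (hatRho ρ)

/-! ### Factorizations -/

/-- The factorization `f : ℕ → List ℕ` stores the block `ρ^{(i)}` at index `i ≥ 1`
(blocks indexed from the right); the largest index of a nonempty block. -/
def topIdx (f : ℕ → List ℕ) : ℕ := sSup {i : ℕ | f i ≠ []}

/-- The concatenation `ρ^{(top)} ⋯ ρ^{(i+1)} ρ^{(i)}` of the blocks of `f` with index `≥ i`. -/
def factWordGe (f : ℕ → List ℕ) (i : ℕ) : List ℕ :=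
  ((((List.range (topIdx f + 1)).reverse).filter (fun j => decide (i ≤ j))).map f).foldr
    (· ++ ·) []

/-- The underlying word of a factorization. -/
def factWord (f : ℕ → List ℕ) : List ℕ := factWordGe f 0

/-- The weak Edelman–Greene recording tableau of a factorization: it has the same shape as
the weak EG insertion tableau of the underlying word, and has entry `i` in all boxes of
`P̂(ρ^{(k)}|⋯|ρ^{(i)})` that are not in `P̂(ρ^{(k)}|⋯|ρ^{(i+1)})`. -/
def hatQfact (f : ℕ → List ℕ) : Tableau := fun r c =>
  sSup {i : ℕ | 1 ≤ i ∧ hatP (factWordGe f i) r c ≠ 0 ∧ hatP (factWordGe f (i + 1)) r c = 0}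

/-- Every block is strictly increasing. -/
def IncreasingFact (f : ℕ → List ℕ) : Prop := ∀ i, List.Chain' (· < ·) (f i)

/-- The factorization is `φ`-flagged: every nonempty block `ρ^{(i)}` has first letter
`ρ^{(i)}_1` with `φ(ρ^{(i)}_1) ≥ i`. -/
def FlaggedFact (φ : ℕ → ℕ) (f : ℕ → List ℕ) : Prop :=
  ∀ i, f i ≠ [] → i ≤ φ ((f i).headI)

/-- `RFC(w, φ)`: all `φ`-flagged increasing factorizations of reduced words for `w`. -/
def RFCset (w : Equiv.Perm ℕ) (φ : ℕ → ℕ) : Set (ℕ → List ℕ) :=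
  {f | f 0 = [] ∧ {i : ℕ | f i ≠ []}.Finite ∧ IncreasingFact f ∧ FlaggedFact φ f ∧
       IsReducedWordFor w (factWord f)}

/-- `RF_n(w)`: increasing factorizations of reduced words for `w` with exactly `n` blocks
(indexed `1, …, n`, possibly empty). -/
def RFn (n : ℕ) (w : Equiv.Perm ℕ) : Set (ℕ → List ℕ) :=
  {f | f 0 = [] ∧ (∀ j, n < j → f j = []) ∧ IncreasingFact f ∧
       IsReducedWordFor w (factWord f)}

/-- `RFC_n(w, φ)`: the `φ`-flagged elements of `RF_n(w)`. -/
def RFCn (n : ℕ) (w : Equiv.Perm ℕ) (φ : ℕ → ℕ) : Set (ℕ → List ℕ) :=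
  {f | f ∈ RFn n w ∧ FlaggedFact φ f}

/-! ### Morse–Schilling crystal operators -/

/-- Pairing procedure: first argument is the block `r^{(i)}` in *decreasing* order, second is
the not-yet-paired part of the block `r^{(i+1)}` (in increasing order). Each letter `b` of
`r^{(i)}`, from largest to smallest, is paired with the smallest still unpaired letter of
`r^{(i+1)}` strictly larger than `b`. Returns the unpaired letters of `r^{(i+1)}`. -/
def unpairedUpper : List ℕ → List ℕ → List ℕ
  | [], A => A
  | b :: bs, A =>
    match A.find? (fun a => decide (b < a)) with
    | some a => unpairedUpper bs (A.erase a)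
    | none => unpairedUpper bs A

/-- As in `unpairedUpper`, but returns the unpaired letters of `r^{(i)}`. -/
def unpairedLower : List ℕ → List ℕ → List ℕ
  | [], _ => []
  | b :: bs, A =>
    match A.find? (fun a => decide (b < a)) with
    | some a => unpairedLower bs (A.erase a)
    | none => b :: unpairedLower bs A

/-- Insert a letter into a weakly increasing list, keeping it increasing. -/
def insAsc (x : ℕ) : List ℕ → List ℕ
  | [] => [x]
  | y :: ys => if x ≤ y then x :: y :: ys else y :: insAsc x ys

/-- The Morse–Schilling raising operator `e_i`: if every letter of block `i+1` is paired,
the result is `none` (i.e. `0`); otherwise the largest unpaired letter `a` of block `i+1` is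
removed and `a + s` is added to block `i`, where `s = min {j ≥ 0 | a+j+1 ∉ r^{(i+1)}}`. -/
def msE (i : ℕ) (f : ℕ → List ℕ) : Option (ℕ → List ℕ) :=
  let B := f i
  let A := f (i + 1)
  let L := unpairedUpper B.reverse A
  if L = [] then none
  else
    let a := L.foldr max 0
    let s := sInf {j : ℕ | (a + j + 1) ∉ A}
    some (Function.update (Function.update f (i + 1) (A.erase a)) i (insAsc (a + s) B))

/-- The Morse–Schilling lowering operator `f_i`: if every letter of block `i` is paired,
the result is `none`; otherwise the smallest unpaired letter `b` of block `i` is removed and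
`b - t` is added to block `i+1`, where `t = min {j ≥ 0 | b-j-1 ∉ r^{(i)}}`. -/
def msF (i : ℕ) (f : ℕ → List ℕ) : Option (ℕ → List ℕ) :=
  let B := f i
  let A := f (i + 1)
  let R := unpairedLower B.reverse A
  if R = [] then none
  else
    let b := R.foldr min R.headI
    let t := sInf {j : ℕ | (b - j - 1) ∉ B}
    some (Function.update (Function.update f i (B.erase b)) (i + 1) (insAsc (b - t) A))

/-- Iteration `e_j^k` of the raising operator. -/
def msEIter (j : ℕ) : ℕ → (ℕ → List ℕ) → Option (ℕ → List ℕ)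
  | 0, f => some f
  | k + 1, f => (msE j f).bind (msEIter j k)

/-- The Demazure operator `𝔇_j` on subsets of the crystal `RF_n(w)`:
`𝔇_j X = {b ∈ RF_n(w) | e_j^k(b) ∈ X for some k ≥ 0}`. -/
def demOp (n : ℕ) (w : Equiv.Perm ℕ) (j : ℕ) (X : Set (ℕ → List ℕ)) : Set (ℕ → List ℕ) :=
  {b | b ∈ RFn n w ∧ ∃ (k : ℕ) (c : ℕ → List ℕ), msEIter j k b = some c ∧ c ∈ X}

/-- `𝔇_{i_1} 𝔇_{i_2} ⋯ 𝔇_{i_k} X` for a word `i_1 i_2 ⋯ i_k` (the head is applied last). -/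
def demWord (n : ℕ) (w : Equiv.Perm ℕ) : List ℕ → Set (ℕ → List ℕ) → Set (ℕ → List ℕ)
  | [], X => X
  | j :: rest, X => demOp n w j (demWord n w rest X)

/-- `𝔇_{b↓a} = 𝔇_{b-1} 𝔇_{b-2} ⋯ 𝔇_a` (the identity when `b ≤ a`). -/
def demDown (n : ℕ) (w : Equiv.Perm ℕ) (b a : ℕ) (X : Set (ℕ → List ℕ)) :
    Set (ℕ → List ℕ) :=
  demWord n w ((List.range' a (b - a)).reverse) X

/-! ### Key tableaux -/

/-- A key tableau: a filling of a left-justified diagram in the positively indexed rows,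
with positive entries, weakly decreasing rows, distinct column entries, and the key
condition (c) of Assaf–Schilling. -/
def IsKeyTableau (T : Tableau) : Prop :=
  (∀ (r : ℤ) (c : ℕ), r ≤ 0 → T r c = 0) ∧
  (∀ r : ℤ, T r 0 = 0) ∧
  {p : ℤ × ℕ | T p.1 p.2 ≠ 0}.Finite ∧
  (∀ (r : ℤ) (c : ℕ), 1 ≤ c → T r (c + 1) ≠ 0 → T r c ≠ 0) ∧
  (∀ (r : ℤ) (c : ℕ), 1 ≤ c → T r (c + 1) ≠ 0 → T r (c + 1) ≤ T r c) ∧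
  (∀ (r r' : ℤ) (c : ℕ), r ≠ r' → T r c ≠ 0 → T r' c ≠ 0 → T r c ≠ T r' c) ∧
  (∀ (r r' : ℤ) (c : ℕ), r < r' → T r c ≠ 0 → T r' c ≠ 0 → T r' c < T r c →
      T r (c + 1) ≠ 0 ∧ T r' c < T r (c + 1))

/-- The tableau is `φ`-flagged: every entry in row `i` is at most `φ(i)`. -/
def FlaggedTab (φ : ℕ → ℕ) (T : Tableau) : Prop := ∀ (i c : ℕ), T (i : ℤ) c ≤ φ i

/-- `SSKT(α, φ)`: the `φ`-flagged key tableaux of shape `α`. -/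
def SSKT (α φ : ℕ → ℕ) : Set Tableau :=
  {T | IsKeyTableau T ∧ shapeOf T = α ∧ FlaggedTab φ T}

/-- The weight of a tableau: `wt(T)_v` is the number of entries equal to `v`. -/
def wtTab (T : Tableau) : ℕ → ℕ := fun v =>
  if v = 0 then 0 else Set.ncard {p : ℤ × ℕ | T p.1 p.2 = v}

/-- The weight of a word: the multiplicity of each positive letter. -/
def wtWord (u : List ℕ) : ℕ → ℕ := fun v => if v = 0 then 0 else u.count v

/-- The statistic `m_i(col(T), j)` where position `j` of the reverse column reading word
(entries read down columns, from right to left) is the box in row `r`, column `c`: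
the number of entries `i+1` weakly after this box minus the number of entries `i`. -/
def mi (T : Tableau) (i : ℕ) (r : ℤ) (c : ℕ) : ℤ :=
  (Set.ncard {p : ℤ × ℕ | T p.1 p.2 = i + 1 ∧ (p.2 < c ∨ (p.2 = c ∧ p.1 ≤ r))} : ℤ) -
  (Set.ncard {p : ℤ × ℕ | T p.1 p.2 = i ∧ (p.2 < c ∨ (p.2 = c ∧ p.1 ≤ r))} : ℤ)

/-- The box `(r, c)` maximizes `m_i` among all boxes of `T`. -/
def isMaxBox (T : Tableau) (i : ℕ) (r : ℤ) (c : ℕ) : Prop :=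
  T r c ≠ 0 ∧ ∀ (r' : ℤ) (c' : ℕ), T r' c' ≠ 0 → mi T i r' c' ≤ mi T i r c

/-- The Assaf–Schilling raising operator `e_i` on key tableaux.  If `m_i(col(T)) ≤ 0` the
result is `none` (i.e. `0`); otherwise, with `q` the largest position of the reverse column
reading word achieving the maximum (i.e. the maximizing box with the smallest column index,
and the smallest row index in that column), all entries `i+1` in the row of `q` weakly to its
right are changed to `i`, and all entries `i` in the same columns as these entries are
changed to `i+1`. -/
def keyE (i : ℕ) (T : Tableau) : Option Tableau :=
  if h : ∃ (r : ℤ) (c : ℕ), isMaxBox T i r c ∧ 1 ≤ mi T i r c then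
    let cq := sInf {c : ℕ | ∃ r : ℤ, isMaxBox T i r c}
    let rq : ℤ := ((sInf {m : ℕ | isMaxBox T i ((m : ℕ) : ℤ) cq} : ℕ) : ℤ)
    some (fun r c =>
      if cq ≤ c ∧ T rq c = i + 1 then
        (if T r c = i + 1 then i else if T r c = i then i + 1 else T r c)
      else T r c)
  else none

/-- The Assaf–Schilling lowering operator `f_i`: the (unique) inverse of `e_i`. -/
def keyF (i : ℕ) (T : Tableau) : Option Tableau :=
  if h : ∃ T', keyE i T' = some T then some h.choose else none

/-- Restriction of a partially defined crystal operator to a subset: the operator returns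
`none` (i.e. `0`) whenever it would leave the subset. -/
def restrictOp {β : Type} (S : Set β) (op : β → Option β) (x : β) : Option β :=
  (op x).bind fun y => if y ∈ S then some y else none

/-! ### Polynomials: divided differences and key polynomials -/

/-- The divided difference operator `∂_i f = (f - s_i · f) / (x_i - x_{i+1})`. -/
def divDiff (i : ℕ) (fp : MvPolynomial ℕ ℤ) : MvPolynomial ℕ ℤ :=
  if h : ∃ g : MvPolynomial ℕ ℤ,
      g * (MvPolynomial.X i - MvPolynomial.X (i + 1)) =
        fp - MvPolynomial.rename (fun j => sPerm i j) fp
  then h.choose else 0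

/-- The isobaric divided difference operator `π_i f = ∂_i (x_i f)`. -/
def piOp (i : ℕ) (fp : MvPolynomial ℕ ℤ) : MvPolynomial ℕ ℤ :=
  divDiff i (MvPolynomial.X i * fp)

/-- `π_{i_1} π_{i_2} ⋯ π_{i_k} f` for a word `i_1 i_2 ⋯ i_k` (the head is applied last). -/
def piWord : List ℕ → MvPolynomial ℕ ℤ → MvPolynomial ℕ ℤ
  | [], fp => fp
  | i :: rest, fp => piOp i (piWord rest fp)

/-- `π_{b↓a} = π_{b-1} π_{b-2} ⋯ π_a` (the identity when `b ≤ a`). -/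
def piDown (b a : ℕ) (fp : MvPolynomial ℕ ℤ) : MvPolynomial ℕ ℤ :=
  piWord ((List.range' a (b - a)).reverse) fp

/-- The conjugate of a weak composition: `conjC α t = #{j ≥ 1 | α_j ≥ t}` for `t ≥ 1`. -/
def conjC (α : ℕ → ℕ) (t : ℕ) : ℕ :=
  Set.ncard {j : ℕ | 1 ≤ j ∧ 1 ≤ t ∧ t ≤ α j}

/-- The partition rearrangement of a weak composition (the conjugate of its conjugate). -/
def sortC (α : ℕ → ℕ) : ℕ → ℕ := conjC (conjC α)

/-- The length of a permutation: the common length of its reduced words. -/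
def permLength (w : Equiv.Perm ℕ) : ℕ :=
  sInf {n : ℕ | ∃ ρ : List ℕ, PosWord ρ ∧ wordPerm ρ = w ∧ ρ.length = n}

/-- The monomial `x^β = x_1^{β_1} x_2^{β_2} ⋯`. -/
def xExp (β : ℕ → ℕ) : MvPolynomial ℕ ℤ :=
  ∏ i ∈ Finset.range (sSup {n : ℕ | β n ≠ 0} + 1), MvPolynomial.X i ^ β i

/-- The key polynomial `κ_α = π_w x^λ` where `λ` is the partition rearrangement of `α` and
`w` is the minimal-length permutation of `S∞` with `α · w = λ`. -/
def keyPoly (α : ℕ → ℕ) : MvPolynomial ℕ ℤ :=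
  if h : ∃ (ρ : List ℕ) (w : Equiv.Perm ℕ), IsReducedWordFor w ρ ∧
      (∀ i, α (w i) = sortC α i) ∧
      (∀ v : Equiv.Perm ℕ, (∃ τ, IsReducedWordFor v τ) → (∀ i, α (v i) = sortC α i) →
        permLength w ≤ permLength v)
  then piWord h.choose (xExp (sortC α)) else 0

/-- The `φ`-flagged key polynomial `κ_{(α,φ)} = Σ_{T ∈ SSKT(α,φ)} x^{wt(T)}`. -/
def flaggedKeyPoly (α φ : ℕ → ℕ) : MvPolynomial ℕ ℤ :=
  ∑ᶠ T ∈ SSKT α φ, xExp (wtTab T)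

/-! ### Column insertion, keys, standardization -/

/-- The number of boxes in column `c` of a tableau. -/
def colHeightN (T : Tableau) (c : ℕ) : ℕ := Set.ncard {r : ℤ | T r c ≠ 0}

/-- One pass of column insertion: insert the value `x` starting at column `c`
(`fuel` bounds the number of columns visited). -/
def colInsertAux : ℕ → Tableau → ℕ → ℕ → Tableau
  | 0, T, _, _ => T
  | fuel + 1, T, c, x =>
    if ∀ r : ℤ, T r c ≠ 0 → T r c < x then
      -- x is greater than every entry of column c: place it at the end of the column
      fun r c' => if c' = c ∧ r = (colHeightN T c + 1 : ℤ) then x else T r c'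
    else if ∃ r : ℤ, T r c = x then
      -- column c contains x: move on to the next column with the same value
      colInsertAux fuel T (c + 1) x
    else
      -- bump the smallest entry of column c that is larger than x
      let y := sInf {v : ℕ | x < v ∧ ∃ r : ℤ, T r c = v}
      colInsertAux fuel (fun r c' => if c' = c ∧ T r c' = y then x else T r c') (c + 1) y

/-- Column insertion of `x` into the semistandard Young tableau `T`. -/
def colInsert (T : Tableau) (x : ℕ) : Tableau :=
  colInsertAux (sSup {c : ℕ | ∃ r : ℤ, T r c ≠ 0} + 2) T 1 x

/-- The insertion tableau `P` of `(v → ∅)`: successively column insert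
`v_n, v_{n-1}, …, v_1` into the empty tableau. -/
def insertP (v : List ℕ) : Tableau :=
  v.reverse.foldl colInsert (fun _ _ => 0)

/-- The recording tableau `Q` of `(v → ∅)`: the standard Young tableau whose restriction to
`{1, …, j}` has the same shape as the insertion tableau of the last `j` letters of `v`. -/
def insertQ (v : List ℕ) : Tableau := fun r c =>
  sInf {j : ℕ | insertP (v.drop (v.length - j)) r c ≠ 0}

/-- The key `key(α)`: the unique semistandard Young tableau of weight `α` such that the set
of entries of column `i+1` is a subset of the entries of column `i`; its column `c` consists
of the elements of `{x ≥ 1 | α_x ≥ c}` in increasing order from bottom to top. -/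
def keyTab (α : ℕ → ℕ) : Tableau := fun r c =>
  if c = 0 then 0
  else sInf {x : ℕ | 1 ≤ x ∧ c ≤ α x ∧
    ((Set.ncard {y : ℕ | 1 ≤ y ∧ c ≤ α y ∧ y ≤ x} : ℕ) : ℤ) = r}

/-- The standardization of a semistandard Young tableau: the `1`'s are replaced from left to
right by `1, …, β_1`, the `2`'s by `β_1 + 1, …, β_1 + β_2`, and so on. -/
def stdTab (T : Tableau) : Tableau := fun r c =>
  if T r c = 0 then 0
  else Set.ncard {p : ℤ × ℕ |
    T p.1 p.2 ≠ 0 ∧ (T p.1 p.2 < T r c ∨ (T p.1 p.2 = T r c ∧ p.2 ≤ c))}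

/-! ### Maximal factorizations (Reiner–Shimozono) -/

/-- Every block is weakly increasing. -/
def WeaklyIncrFact (g : ℕ → List ℕ) : Prop := ∀ i, List.Chain' (· ≤ ·) (g i)

/-- Maximality: the nonempty blocks have maximal length, i.e. there is a strict descent
between any two consecutive nonempty blocks (no letter can be moved from the end of a block
to the front of the next one to the right). -/
def MaxFact (g : ℕ → List ℕ) : Prop :=
  ∀ i j : ℕ, 1 ≤ i → i < j → g i ≠ [] → g j ≠ [] → (∀ m, i < m → m < j → g m = []) →
    (g i).headI < (g j).getLastD 0

/-- Reiner–Shimozono's set `𝒲(α, φ)` of `φ`-flagged maximal factorizations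
`u^• = u^n ⋯ u^2 u^1` with `ℓ(u^i) = α_i` and `(u → ∅) = (P, std(key(α)))`. -/
def Wset (α φ : ℕ → ℕ) : Set (ℕ → List ℕ) :=
  {g | g 0 = [] ∧ (∀ i, (g i).length = α i) ∧ (∀ i, ∀ x ∈ g i, 1 ≤ x) ∧
       WeaklyIncrFact g ∧ MaxFact g ∧ (∀ i, ∀ x ∈ g i, x ≤ φ i) ∧
       insertQ (factWord g) = stdTab (keyTab α)}

/-! ### Shifts and highest weight key tableaux -/

/-- `shift_N`: add `N` to every letter of every block. -/
def shiftFact (N : ℕ) (f : ℕ → List ℕ) : ℕ → List ℕ := fun i => (f i).map (· + N)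

/-- The tableau of shape `α` whose column `i` is filled by `1, 2, …, λ^T_i` in increasing
order from bottom to top (where `λ^T` is the conjugate of the partition rearrangement `λ`
of `α`): the box of column `c` in row `m` (where `α_m ≥ c`) contains the number of indices
`m' ≤ m` with `α_{m'} ≥ c`. -/
def highKeyTab (α : ℕ → ℕ) : Tableau := fun r c =>
  if c = 0 then 0
  else if ∃ m : ℕ, (m : ℤ) = r ∧ 1 ≤ m ∧ c ≤ α m then
    Set.ncard {m : ℕ | 1 ≤ m ∧ c ≤ α m ∧ (m : ℤ) ≤ r}
  else 0


/-- A `gl_n`-crystal isomorphism between two sets of key tableaux, both equipped with the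
Assaf–Schilling operators (restricted to the sets): a weight-preserving bijection commuting
with all raising and lowering operators `e_i, f_i` for `1 ≤ i < n`. -/
def SSKTIso (n : ℕ) (S₁ S₂ : Set Tableau) : Prop :=
  ∃ g : Tableau → Tableau, Set.BijOn g S₁ S₂ ∧
    (∀ T ∈ S₁, wtTab T = wtTab (g T)) ∧
    ∀ T ∈ S₁, ∀ i : ℕ, 1 ≤ i → i < n →
      Option.map g (restrictOp S₁ (keyE i) T) = restrictOp S₂ (keyE i) (g T) ∧
      Option.map g (restrictOp S₁ (keyF i) T) = restrictOp S₂ (keyF i) (g T)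

/-! ### Products of adjacent transpositions -/

theorem sPerm_mul_comm {x y : ℕ} (h : x + 1 < y) : sPerm x * sPerm y = sPerm y * sPerm x := by
  ext z
  simp only [sPerm, Equiv.Perm.mul_apply, Equiv.swap_apply_def]
  split_ifs <;> omega

theorem sPerm_mul_self (x : ℕ) : sPerm x * sPerm x = 1 := by
  simp [sPerm]

theorem sPerm_braid (x : ℕ) :
    sPerm x * sPerm (x + 1) * sPerm x = sPerm (x + 1) * sPerm x * sPerm (x + 1) := by
  ext z
  simp only [sPerm, Equiv.Perm.mul_apply, Equiv.swap_apply_def]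
  split_ifs <;> omega

theorem wordPerm_append (u v : List ℕ) : wordPerm (u ++ v) = wordPerm u * wordPerm v := by
  simp [wordPerm]

theorem wordPerm_singleton (x : ℕ) : wordPerm [x] = sPerm x := by
  simp [wordPerm]

theorem wordPerm_cons (x : ℕ) (v : List ℕ) : wordPerm (x :: v) = sPerm x * wordPerm v := by
  simp [wordPerm]

theorem commute_wordPerm {u v : List ℕ} (h : ∀ x ∈ u, ∀ y ∈ v, x + 1 < y ∨ y + 1 < x) :
    Commute (wordPerm u) (wordPerm v) := by
  refine Commute.list_prod_left _ _ fun p hp => Commute.list_prod_right _ _ fun q hq => ?_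
  obtain ⟨x, hx, rfl⟩ := List.mem_map.1 hp
  obtain ⟨y, hy, rfl⟩ := List.mem_map.1 hq
  rcases h x hx y hy with h | h
  · exact sPerm_mul_comm h
  · exact (sPerm_mul_comm h).symm

theorem wordPerm_range'_succ (a s : ℕ) :
    wordPerm (List.range' a (s + 1)) = wordPerm (List.range' a s) * sPerm (a + s) := by
  rw [List.range'_concat, wordPerm_append, wordPerm_singleton, one_mul]

theorem wordPerm_range'_mul_range' (a s : ℕ) :
    wordPerm (List.range' a (s + 1)) * wordPerm (List.range' a s) =
      wordPerm (List.range' (a + 1) s) * wordPerm (List.range' a (s + 1)) := by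
  induction s with
  | zero => simp [wordPerm]
  | succ s ih =>
    have hc : wordPerm (List.range' a s) * sPerm (a + s + 1) =
        sPerm (a + s + 1) * wordPerm (List.range' a s) := by
      rw [← wordPerm_singleton]
      refine commute_wordPerm fun x hx y hy => ?_
      simp only [List.mem_range'_1, List.mem_singleton] at hx hy
      omega
    have hb := sPerm_braid (a + s)
    have e1 := wordPerm_range'_succ a s
    have e2 := wordPerm_range'_succ a (s + 1)
    have e3 := wordPerm_range'_succ (a + 1) s
    rw [show a + (s + 1) = a + s + 1 by ring] at e2
    rw [show a + 1 + s = a + s + 1 by ring] at e3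
    generalize wordPerm (List.range' a s) = c at *
    generalize wordPerm (List.range' (a + 1) s) = d at *
    rw [e2, e3, e1]
    rw [e1] at ih
    generalize sPerm (a + s) = p at *
    generalize sPerm (a + s + 1) = q at *
    calc c * p * q * (c * p) = c * p * (q * c) * p := by group
      _ = c * p * c * (q * p) := by rw [← hc]; group
      _ = d * c * (p * q * p) := by rw [ih]; group
      _ = d * (c * q) * p * q := by rw [hb]; group
      _ = d * q * (c * p * q) := by rw [hc]; group

/-- The commutation and braid relations behind one application of the raising operator. -/
theorem wordPerm_raise {a s : ℕ} {A₁ A₂ B₁ : List ℕ} (B₂ : List ℕ)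
    (hA₂ : ∀ x ∈ A₂, a + s + 1 < x) (hB₁ : ∀ x ∈ B₁, x + 1 < a) :
    wordPerm ((A₁ ++ List.range' a (s + 1) ++ A₂) ++ (B₁ ++ List.range' a s ++ B₂)) =
      wordPerm ((A₁ ++ List.range' (a + 1) s ++ A₂) ++
        (B₁ ++ List.range' a (s + 1) ++ B₂)) := by
  have h1 : Commute (wordPerm (List.range' a (s + 1))) (wordPerm (A₂ ++ B₁)) := by
    refine commute_wordPerm fun x hx y hy => ?_
    rw [List.mem_range'_1] at hx
    rcases List.mem_append.1 hy with hy | hy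
    · have := hA₂ y hy; omega
    · have := hB₁ y hy; omega
  have h2 : Commute (wordPerm (List.range' (a + 1) s)) (wordPerm (A₂ ++ B₁)) := by
    refine commute_wordPerm fun x hx y hy => ?_
    rw [List.mem_range'_1] at hx
    rcases List.mem_append.1 hy with hy | hy
    · have := hA₂ y hy; omega
    · have := hB₁ y hy; omega
  have h3 := wordPerm_range'_mul_range' a s
  simp only [wordPerm_append] at *
  generalize wordPerm (List.range' a (s + 1)) = c at *
  generalize wordPerm (List.range' a s) = c' at *
  generalize wordPerm (List.range' (a + 1) s) = d at *
  generalize wordPerm A₁ = p at *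
  generalize wordPerm A₂ = q at *
  generalize wordPerm B₁ = r at *
  generalize wordPerm B₂ = t at *
  calc p * c * q * (r * c' * t) = p * (c * (q * r)) * c' * t := by group
    _ = p * (q * r) * (c * c') * t := by rw [h1.eq]; group
    _ = p * ((q * r) * d) * c * t := by rw [h3]; group
    _ = p * d * q * (r * c * t) := by rw [← h2.eq]; group

/-! ### Strictly increasing lists -/

theorem eq_of_pairwise_lt_of_mem_iff {u v : List ℕ} (hu : u.Pairwise (· < ·))
    (hv : v.Pairwise (· < ·)) (h : ∀ x, x ∈ u ↔ x ∈ v) : u = v := by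
  refine List.Perm.eq_of_pairwise (le := (· < ·)) (fun x y _ _ h1 h2 => ?_) hu hv ?_
  · exact absurd h1 (lt_asymm h2)
  · exact (List.perm_ext_iff_of_nodup (hu.imp (fun h => ne_of_lt h))
      (hv.imp (fun h => ne_of_lt h))).2 h

theorem mem_insAsc {x y : ℕ} {u : List ℕ} : y ∈ insAsc x u ↔ y = x ∨ y ∈ u := by
  induction u with
  | nil => simp [insAsc]
  | cons z u ih =>
    simp only [insAsc]
    split_ifs <;> simp [ih]
    tauto

theorem length_insAsc (x : ℕ) (u : List ℕ) : (insAsc x u).length = u.length + 1 := by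
  induction u with
  | nil => simp [insAsc]
  | cons z u ih =>
    simp only [insAsc]
    split_ifs <;> simp [ih]

theorem pairwise_insAsc {x : ℕ} {u : List ℕ} (hu : u.Pairwise (· < ·)) (hx : x ∉ u) :
    (insAsc x u).Pairwise (· < ·) := by
  induction u with
  | nil => simp [insAsc]
  | cons z u ih =>
    rw [List.pairwise_cons] at hu
    rw [List.mem_cons, not_or] at hx
    simp only [insAsc]
    split_ifs with h
    · refine List.pairwise_cons.2 ⟨fun y hy => ?_, List.pairwise_cons.2 hu⟩
      rcases List.mem_cons.1 hy with rfl | hy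
      · omega
      · have := hu.1 y hy; omega
    · refine List.pairwise_cons.2 ⟨fun y hy => ?_, ih hu.2 hx.2⟩
      rcases mem_insAsc.1 hy with rfl | hy
      · omega
      · exact hu.1 y hy

theorem mem_erase_iff_of_pairwise_lt {u : List ℕ} (hu : u.Pairwise (· < ·)) {x y : ℕ} :
    y ∈ u.erase x ↔ y ≠ x ∧ y ∈ u :=
  List.Nodup.mem_erase_iff (hu.imp (fun h => ne_of_lt h))

theorem eq_append_range'_append {u : List ℕ} (hu : u.Pairwise (· < ·)) (a k : ℕ)
    (h : ∀ x, a ≤ x → x < a + k → x ∈ u) :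
    u = u.filter (fun x => decide (x < a)) ++ List.range' a k ++
      u.filter (fun x => decide (a + k ≤ x)) := by
  refine eq_of_pairwise_lt_of_mem_iff hu ?_ fun x => ?_
  · simp only [List.pairwise_append, List.mem_append, List.mem_filter, List.mem_range'_1,
      decide_eq_true_eq]
    refine ⟨⟨hu.filter _, List.pairwise_lt_range', ?_⟩, hu.filter _, ?_⟩
    · intro x hx y hy; omega
    · intro x hx y hy; omega
  · simp only [List.mem_append, List.mem_filter, List.mem_range'_1, decide_eq_true_eq]
    have := h x
    constructor
    · intro hx
      simp only [hx, true_and]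
      omega
    · rintro ((h | h) | h)
      · exact h.1
      · exact this h.1 h.2
      · exact h.1

theorem find?_lt_eq_some {A : List ℕ} (hA : A.Pairwise (· < ·)) {b x : ℕ}
    (h : A.find? (fun a => decide (b < a)) = some x) :
    x ∈ A ∧ b < x ∧ ∀ y ∈ A, b < y → x ≤ y := by
  refine ⟨List.mem_of_find?_eq_some h, by simpa using List.find?_some h, ?_⟩
  induction A with
  | nil => simp at h
  | cons z A ih =>
    rw [List.pairwise_cons] at hA
    intro y hy hby
    rw [List.find?_cons] at h
    by_cases hz : b < z
    · simp only [hz, decide_true, Option.some.injEq] at h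
      rcases List.mem_cons.1 hy with rfl | hy
      · omega
      · have := hA.1 y hy; omega
    · simp only [hz, decide_false] at h
      rcases List.mem_cons.1 hy with rfl | hy
      · omega
      · exact ih hA.2 h y hy hby

/-! ### The pairing procedure -/

theorem mem_of_mem_unpairedUpper {bs A : List ℕ} {x : ℕ} (h : x ∈ unpairedUpper bs A) :
    x ∈ A := by
  induction bs generalizing A with
  | nil => exact h
  | cons b bs ih =>
    rw [unpairedUpper] at h
    split at h
    · exact List.mem_of_mem_erase (ih h)
    · exact ih h

theorem exists_lt_of_notMem_unpairedUpper {bs A : List ℕ} {x : ℕ} (hx : x ∈ A)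
    (h : x ∉ unpairedUpper bs A) : ∃ b ∈ bs, b < x := by
  induction bs generalizing A with
  | nil => exact absurd hx h
  | cons b bs ih =>
    rw [unpairedUpper] at h
    split at h
    · rename_i y hy
      by_cases hxy : x = y
      · subst hxy
        exact ⟨b, by simp, by simpa using List.find?_some hy⟩
      · obtain ⟨c, hc, hcx⟩ := ih ((List.mem_erase_of_ne hxy).2 hx) h
        exact ⟨c, by simp [hc], hcx⟩
    · obtain ⟨c, hc, hcx⟩ := ih hx h
      exact ⟨c, by simp [hc], hcx⟩

theorem pred_notMem_of_mem_unpairedUpper {bs A : List ℕ} (hA : A.Pairwise (· < ·)) {b : ℕ}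
    (h : b + 1 ∈ unpairedUpper bs A) : b ∉ bs := by
  induction bs generalizing A with
  | nil => simp
  | cons c bs ih =>
    have hmem := mem_of_mem_unpairedUpper h
    rw [unpairedUpper] at h
    split at h
    · rename_i x hx
      obtain ⟨_, hcx, hmin⟩ := find?_lt_eq_some hA hx
      have hbx := (mem_erase_iff_of_pairwise_lt hA).1 (mem_of_mem_unpairedUpper h)
      rw [List.mem_cons, not_or]
      refine ⟨?_, ih (hA.sublist List.erase_sublist) h⟩
      rintro rfl
      have := hmin _ hmem (Nat.lt_succ_self _)
      omega
    · rename_i hx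
      rw [List.mem_cons, not_or]
      refine ⟨?_, ih hA h⟩
      rintro rfl
      simpa using List.find?_eq_none.1 hx _ hmem

/-- Letters above an unpaired letter `a` are only paired with letters that are at least `a`. -/
theorem card_paired_le {bs A : List ℕ} (hbs : bs.Nodup) (hA : A.Pairwise (· < ·)) {a : ℕ}
    (h : a ∈ unpairedUpper bs A) (y : ℕ) :
    (A.toFinset.filter fun x => x ∉ unpairedUpper bs A ∧ a < x ∧ x ≤ y).card ≤
      (bs.toFinset.filter fun b => a ≤ b ∧ b < y).card := by
  induction bs generalizing A with
  | nil =>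
    rw [Finset.card_eq_zero.2]
    · exact Nat.zero_le _
    · refine Finset.filter_eq_empty_iff.2 fun x hx => ?_
      simp only [unpairedUpper]
      simp_all
  | cons b bs ih =>
    have hmem := mem_of_mem_unpairedUpper h
    rw [List.nodup_cons] at hbs
    have hmono : (bs.toFinset.filter fun b => a ≤ b ∧ b < y) ⊆
        ((b :: bs).toFinset.filter fun b => a ≤ b ∧ b < y) := by
      intro z
      simp only [Finset.mem_filter, List.mem_toFinset, List.mem_cons]
      tauto
    rw [unpairedUpper] at h
    split at h
    · rename_i x hx
      have e : unpairedUpper (b :: bs) A = unpairedUpper bs (A.erase x) := by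
        simp [unpairedUpper, hx]
      rw [e]
      obtain ⟨hxA, hbx, hmin⟩ := find?_lt_eq_some hA hx
      have hA' := hA.sublist (List.erase_sublist (a := x))
      have ih' := ih hbs.2 hA' h
      by_cases hxr : a < x ∧ x ≤ y
      · have hab : a ≤ b := by
          by_contra hab
          have := hmin a hmem (by omega)
          omega
        have hsub : (A.toFinset.filter fun z =>
            z ∉ unpairedUpper bs (A.erase x) ∧ a < z ∧ z ≤ y) ⊆
            insert x ((A.erase x).toFinset.filter fun z =>
              z ∉ unpairedUpper bs (A.erase x) ∧ a < z ∧ z ≤ y) := by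
          intro z
          simp only [Finset.mem_filter, List.mem_toFinset, Finset.mem_insert,
            mem_erase_iff_of_pairwise_lt hA]
          tauto
        have hins : insert b (bs.toFinset.filter fun b => a ≤ b ∧ b < y) ⊆
            ((b :: bs).toFinset.filter fun b => a ≤ b ∧ b < y) := by
          refine Finset.insert_subset ?_ hmono
          simp only [Finset.mem_filter, List.mem_toFinset, List.mem_cons, true_or, true_and]
          omega
        have hc := Finset.card_le_card hins
        rw [Finset.card_insert_of_notMem (by simp [hbs.1])] at hc
        exact (Finset.card_le_card hsub).trans
          ((Finset.card_insert_le _ _).trans (by omega))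
      · refine le_trans (Finset.card_le_card ?_) (ih'.trans (Finset.card_le_card hmono))
        intro z
        simp only [Finset.mem_filter, List.mem_toFinset, mem_erase_iff_of_pairwise_lt hA]
        rintro ⟨hz, hzL, hzr⟩
        refine ⟨⟨?_, hz⟩, hzL, hzr⟩
        rintro rfl
        exact hxr hzr
    · rename_i hx
      have e : unpairedUpper (b :: bs) A = unpairedUpper bs A := by
        simp [unpairedUpper, hx]
      rw [e]
      exact (ih hbs.2 hA h).trans (Finset.card_le_card hmono)

theorem mem_of_mem_unpairedUpper_of_range {bs A : List ℕ} (hbs : bs.Nodup)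
    (hA : A.Pairwise (· < ·)) {a s : ℕ} (h : a ∈ unpairedUpper bs A)
    (hmax : ∀ x ∈ unpairedUpper bs A, x ≤ a) (hs : ∀ j < s, a + j + 1 ∈ A) :
    ∀ x, a ≤ x → x < a + s → x ∈ bs := by
  have hcard := card_paired_le hbs hA h (a + s)
  have h1 : Finset.Ioc a (a + s) ⊆
      A.toFinset.filter fun x => x ∉ unpairedUpper bs A ∧ a < x ∧ x ≤ a + s := by
    intro x hx
    rw [Finset.mem_Ioc] at hx
    refine Finset.mem_filter.2 ⟨List.mem_toFinset.2 ?_, fun hxL => ?_, hx⟩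
    · have := hs (x - a - 1) (by omega)
      rwa [show a + (x - a - 1) + 1 = x by omega] at this
    · have := hmax x hxL
      omega
  have h2 : (bs.toFinset.filter fun b => a ≤ b ∧ b < a + s) ⊆ Finset.Ico a (a + s) := by
    intro x hx
    exact Finset.mem_Ico.2 (Finset.mem_filter.1 hx).2
  have h3 := Finset.card_le_card h1
  have h4 := Finset.eq_of_subset_of_card_le h2 (by
    rw [Nat.card_Ioc] at h3
    rw [Nat.card_Ico]
    omega)
  intro x hx hx'
  have : x ∈ Finset.Ico a (a + s) := Finset.mem_Ico.2 ⟨hx, hx'⟩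
  rw [← h4] at this
  exact List.mem_toFinset.1 (Finset.mem_filter.1 this).1

theorem foldr_max_mem {L : List ℕ} (h : L ≠ []) : L.foldr max 0 ∈ L := by
  induction L with
  | nil => exact absurd rfl h
  | cons x L ih =>
    by_cases hL : L = []
    · simp [hL]
    · rw [List.foldr_cons]
      rcases max_choice x (L.foldr max 0) with h | h <;> rw [h]
      · simp
      · simp [ih hL]

theorem le_foldr_max {L : List ℕ} {x : ℕ} (h : x ∈ L) : x ≤ L.foldr max 0 := by
  induction L with
  | nil => simp at h
  | cons y L ih =>
    rw [List.foldr_cons]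
    rcases List.mem_cons.1 h with rfl | h
    · exact le_max_left _ _
    · exact (ih h).trans (le_max_right _ _)

theorem sInf_gap_notMem (A : List ℕ) (a : ℕ) :
    a + sInf {j : ℕ | a + j + 1 ∉ A} + 1 ∉ A := by
  have hne : {j : ℕ | a + j + 1 ∉ A}.Nonempty := by
    refine ⟨A.foldr max 0, fun h => ?_⟩
    have := le_foldr_max h
    omega
  exact Nat.sInf_mem hne

/-! ### One application of the raising operator -/

/-- The effect of the raising operator on two adjacent blocks `A | B` whose concatenation is
reduced. -/
theorem raise_blocks {A B : List ℕ} (hA : A.Pairwise (· < ·)) (hB : B.Pairwise (· < ·))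
    (hred : IsReducedWord (A ++ B)) {a s : ℕ} (ha : a ∈ unpairedUpper B.reverse A)
    (hmax : ∀ x ∈ unpairedUpper B.reverse A, x ≤ a) (hs : ∀ j < s, a + j + 1 ∈ A)
    (hs' : a + s + 1 ∉ A) :
    a ∈ A ∧ a + s ∉ B ∧ (s = 0 ∨ a ∈ B) ∧
      wordPerm (A.erase a ++ insAsc (a + s) B) = wordPerm (A ++ B) := by
  have haA := mem_of_mem_unpairedUpper ha
  have hrangeB : ∀ x, a ≤ x → x < a + s → x ∈ B := by
    intro x hx hx'
    have := mem_of_mem_unpairedUpper_of_range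
      (List.nodup_reverse.2 (hB.imp (fun h => ne_of_lt h))) hA ha hmax hs x hx hx'
    simpa using this
  have hrangeA : ∀ x, a ≤ x → x < a + (s + 1) → x ∈ A := by
    intro x hx hx'
    rcases Nat.eq_or_lt_of_le hx with rfl | hlt
    · exact haA
    · have := hs (x - a - 1) (by omega)
      rwa [show a + (x - a - 1) + 1 = x by omega] at this
  have hpred : ∀ x ∈ B, x < a → x + 1 < a := by
    intro x hx hxa
    by_contra hcon
    obtain rfl : x + 1 = a := by omega
    exact pred_notMem_of_mem_unpairedUpper hA ha (by simpa using hx)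
  have hpos : 1 ≤ a := hred.1 a (by simp [haA])
  have eA := eq_append_range'_append hA a (s + 1) hrangeA
  have eB := eq_append_range'_append hB a s hrangeB
  set A₁ := A.filter (fun x => decide (x < a)) with hA₁
  set A₂ := A.filter (fun x => decide (a + (s + 1) ≤ x)) with hA₂
  set B₁ := B.filter (fun x => decide (x < a)) with hB₁
  set B₂ := B.filter (fun x => decide (a + s ≤ x)) with hB₂
  have mA₂ : ∀ x ∈ A₂, a + s + 1 < x := by
    intro x hx
    simp only [hA₂, List.mem_filter, decide_eq_true_eq] at hx
    rcases Nat.eq_or_lt_of_le hx.2 with h | h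
    · exact absurd (by simpa [← h, add_assoc] using hx.1) hs'
    · omega
  have mB₁ : ∀ x ∈ B₁, x + 1 < a := by
    intro x hx
    simp only [hB₁, List.mem_filter, decide_eq_true_eq] at hx
    exact hpred x hx.1 hx.2
  have key := wordPerm_raise (A₁ := A₁) B₂ mA₂ mB₁
  rw [← eA, ← eB] at key
  have hnot : a + s ∉ B := by
    intro hmem
    have eB' := eq_append_range'_append hB a (s + 1) fun x hx hx' => by
      rcases Nat.eq_or_lt_of_le (Nat.lt_succ_iff.1 hx') with rfl | h
      · exact hmem
      · exact hrangeB x hx h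
    rw [← hB₁] at eB'
    set B₃ := B.filter (fun x => decide (a + (s + 1) ≤ x)) with hB₃
    have e2 : B₂ = (a + s) :: B₃ := by
      rw [List.range'_concat, one_mul] at eB'
      have := eB.symm.trans eB'
      simpa only [List.append_assoc, List.append_cancel_left_eq, List.singleton_append]
        using this
    have hshort : wordPerm ((A₁ ++ List.range' (a + 1) s ++ A₂) ++
        (B₁ ++ List.range' a s ++ B₃)) = wordPerm (A ++ B) := by
      rw [key, e2]
      simp only [wordPerm_append, wordPerm_cons, wordPerm_range'_succ, mul_assoc]
      rw [← mul_assoc (sPerm _) (sPerm _), sPerm_mul_self, one_mul]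
    have hle := hred.2 _ (fun x hx => ?_) hshort
    · have l1 := congrArg List.length eA
      have l2 := congrArg List.length eB'
      simp only [List.length_append, List.length_range'] at hle l1 l2
      omega
    · simp only [List.mem_append, List.mem_range'_1] at hx
      rcases hx with ((hx | hx) | hx) | ((hx | hx) | hx)
      · exact hred.1 x (by simp [(List.mem_filter.1 hx).1])
      · omega
      · exact hred.1 x (by simp [(List.mem_filter.1 hx).1])
      · exact hred.1 x (by simp [(List.mem_filter.1 hx).1])
      · omega
      · exact hred.1 x (by simp [(List.mem_filter.1 hx).1])
  refine ⟨haA, hnot, ?_, ?_⟩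
  · rcases Nat.eq_zero_or_pos s with h | h
    · exact Or.inl h
    · exact Or.inr (hrangeB a le_rfl (by omega))
  · rw [key]
    congr 2
    · refine eq_of_pairwise_lt_of_mem_iff (hA.sublist List.erase_sublist) ?_ fun x => ?_
      · have : (A₁ ++ List.range' a (s + 1) ++ A₂).Pairwise (· < ·) := eA ▸ hA
        rw [List.range'_succ] at this
        refine this.sublist ?_
        exact ((List.Sublist.refl _).append (List.sublist_cons_self _ _)).append
          (List.Sublist.refl _)
      · rw [mem_erase_iff_of_pairwise_lt hA]
        simp only [hA₁, hA₂, List.mem_append, List.mem_filter, List.mem_range'_1,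
          decide_eq_true_eq]
        have := hrangeA x
        constructor
        · rintro ⟨h1, h2⟩
          simp only [h2, true_and]
          omega
        · rintro ((h | h) | h)
          · exact ⟨by omega, h.1⟩
          · exact ⟨by omega, this (by omega) (by omega)⟩
          · exact ⟨by omega, h.1⟩
    · refine eq_of_pairwise_lt_of_mem_iff (pairwise_insAsc hB hnot) ?_ fun x => ?_
      · simp only [List.pairwise_append, List.mem_append, hB₁, hB₂, List.mem_filter,
          List.mem_range'_1, decide_eq_true_eq]
        refine ⟨⟨hB.filter _, List.pairwise_lt_range', ?_⟩, hB.filter _, ?_⟩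
        · intro x hx y hy; omega
        · intro x hx y hy
          have : y ≠ a + s := by
            rintro rfl
            exact hnot hy.1
          omega
      · rw [mem_insAsc]
        simp only [hB₁, hB₂, List.mem_append, List.mem_filter, List.mem_range'_1,
          decide_eq_true_eq]
        have := hrangeB x
        constructor
        · rintro (h | h)
          · omega
          · simp only [h, true_and]
            omega
        · rintro ((h | h) | h)
          · exact Or.inr h.1
          · by_cases hx : x = a + s
            · exact Or.inl hx
            · exact Or.inr (this h.1 (by omega))
          · exact Or.inr h.1

/-! ### Words of factorizations -/

/-- The concatenation `ρ^{(N)} ⋯ ρ^{(1)} ρ^{(0)}` of the blocks of index at most `N`. -/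
def blocksWord (f : ℕ → List ℕ) : ℕ → List ℕ
  | 0 => f 0
  | N + 1 => f (N + 1) ++ blocksWord f N

theorem mem_blocksWord {f : ℕ → List ℕ} {N x : ℕ} :
    x ∈ blocksWord f N ↔ ∃ m ≤ N, x ∈ f m := by
  induction N with
  | zero => simp [blocksWord]
  | succ N ih =>
    rw [blocksWord, List.mem_append, ih]
    constructor
    · rintro (h | ⟨m, hm, h⟩)
      · exact ⟨_, le_rfl, h⟩
      · exact ⟨m, by omega, h⟩
    · rintro ⟨m, hm, h⟩
      rcases Nat.lt_or_eq_of_le hm with hlt | rfl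
      · exact Or.inr ⟨m, by omega, h⟩
      · exact Or.inl h

theorem blocksWord_eq_of_le {f : ℕ → List ℕ} {M N : ℕ} (hMN : M ≤ N)
    (h : ∀ m, M < m → f m = []) : blocksWord f N = blocksWord f M := by
  induction N, hMN using Nat.le_induction with
  | base => rfl
  | succ N hN ih => rw [blocksWord, h _ (by omega), List.nil_append, ih]

theorem foldr_range_reverse_eq_blocksWord (f : ℕ → List ℕ) (N : ℕ) :
    ((List.range (N + 1)).reverse.map f).foldr (· ++ ·) [] = blocksWord f N := by
  induction N with
  | zero => simp [blocksWord]
  | succ N ih =>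
    rw [List.range_succ, List.reverse_append, List.reverse_singleton, List.singleton_append,
      List.map_cons, List.foldr_cons, ih, blocksWord]

theorem factWord_eq_blocksWord {f : ℕ → List ℕ} {N : ℕ} (h : ∀ m, N < m → f m = []) :
    factWord f = blocksWord f N := by
  have hbdd : BddAbove {i : ℕ | f i ≠ []} := ⟨N, fun i hi => by
    by_contra hcon
    exact hi (h i (by omega))⟩
  have htop : ∀ m, topIdx f < m → f m = [] := by
    intro m hm
    by_contra hcon
    have : m ≤ topIdx f := le_csSup hbdd hcon
    omega
  have e : factWord f = blocksWord f (topIdx f) := by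
    rw [← foldr_range_reverse_eq_blocksWord]
    simp [factWord, factWordGe]
  rw [e]
  rcases le_total (topIdx f) N with hle | hle
  · exact (blocksWord_eq_of_le hle htop).symm
  · exact blocksWord_eq_of_le hle h

theorem blocksWord_congr {f g : ℕ → List ℕ} {N : ℕ} (h : ∀ m ≤ N, f m = g m) :
    blocksWord f N = blocksWord g N := by
  induction N with
  | zero => exact h 0 le_rfl
  | succ N ih => rw [blocksWord, blocksWord, h _ le_rfl, ih fun m hm => h m (by omega)]

/-- Isolating two adjacent blocks of a factorization. -/
theorem exists_blocksWord_eq (f : ℕ → List ℕ) {j n : ℕ} (hj : 1 ≤ j) (hjn : j + 1 ≤ n) :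
    ∃ U V : List ℕ, ∀ g : ℕ → List ℕ, (∀ m, m ≠ j → m ≠ j + 1 → g m = f m) →
      blocksWord g n = U ++ (g (j + 1) ++ g j) ++ V := by
  induction n, hjn using Nat.le_induction with
  | base =>
    obtain ⟨i, rfl⟩ : ∃ i, j = i + 1 := ⟨j - 1, by omega⟩
    refine ⟨[], blocksWord f i, fun g hg => ?_⟩
    rw [blocksWord, blocksWord,
      blocksWord_congr fun m (hm : m ≤ i) => hg m (by omega) (by omega)]
    simp
  | succ n hn ih =>
    obtain ⟨U, V, h⟩ := ih
    refine ⟨f (n + 1) ++ U, V, fun g hg => ?_⟩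
    rw [blocksWord, h g hg, hg _ (by omega) (by omega)]
    simp

theorem isReducedWord_of_append {U u V : List ℕ} (h : IsReducedWord (U ++ u ++ V)) :
    IsReducedWord u := by
  refine ⟨fun x hx => h.1 x (by simp [hx]), fun σ hσ hw => ?_⟩
  have := h.2 (U ++ σ ++ V) (fun x hx => ?_) (by simp only [wordPerm_append, hw])
  · simpa using this
  · simp only [List.mem_append] at hx
    rcases hx with (hx | hx) | hx
    · exact h.1 x (by simp [hx])
    · exact hσ x hx
    · exact h.1 x (by simp [hx])

theorem isReducedWordFor_replace {w : Equiv.Perm ℕ} {U u v V : List ℕ}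
    (h : IsReducedWordFor w (U ++ u ++ V)) (hpos : PosWord v) (hw : wordPerm v = wordPerm u)
    (hlen : v.length = u.length) : IsReducedWordFor w (U ++ v ++ V) := by
  have e : wordPerm (U ++ v ++ V) = wordPerm (U ++ u ++ V) := by
    simp only [wordPerm_append, hw]
  refine ⟨⟨fun x hx => ?_, fun σ hσ hσw => ?_⟩, e.trans h.2⟩
  · simp only [List.mem_append] at hx
    rcases hx with (hx | hx) | hx
    · exact h.1.1 x (by simp [hx])
    · exact hpos x hx
    · exact h.1.1 x (by simp [hx])
  · have := h.1.2 σ hσ (hσw.trans e)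
    simpa [hlen] using this

theorem pairwise_of_mem_RFn {n : ℕ} {w : Equiv.Perm ℕ} {f : ℕ → List ℕ} (hf : f ∈ RFn n w) (m : ℕ) :
    (f m).Pairwise (· < ·) :=
  List.isChain_iff_pairwise.1 (hf.2.2.1 m)

theorem le_of_mem_of_mem_RFn {n : ℕ} {w : Equiv.Perm ℕ} {f : ℕ → List ℕ} (hf : f ∈ RFn n w)
    {m x : ℕ} (hx : x ∈ f m) : m ≤ n := by
  by_contra hcon
  rw [hf.2.1 m (by omega)] at hx
  simp at hx

theorem pos_of_mem_of_mem_RFn {n : ℕ} {w : Equiv.Perm ℕ} {f : ℕ → List ℕ} (hf : f ∈ RFn n w)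
    {m x : ℕ} (hx : x ∈ f m) : 1 ≤ x := by
  refine hf.2.2.2.1.1 x ?_
  rw [factWord_eq_blocksWord hf.2.1]
  exact mem_blocksWord.2 ⟨m, le_of_mem_of_mem_RFn hf hx, hx⟩

/-- The raising operator preserves `RF_n(w)`, and its effect on the letters of the blocks. -/
theorem msE_spec {n : ℕ} {w : Equiv.Perm ℕ} {f g : ℕ → List ℕ} (hf : f ∈ RFn n w) {j : ℕ}
    (hj : 1 ≤ j) (hjn : j < n) (hg : msE j f = some g) :
    g ∈ RFn n w ∧ (∀ m, m ≠ j → m ≠ j + 1 → g m = f m) ∧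
      ∃ a s : ℕ, a ∈ f (j + 1) ∧ a ∈ g j ∧ g (j + 1) = (f (j + 1)).erase a ∧
        g j = insAsc (a + s) (f j) := by
  simp only [msE] at hg
  split_ifs at hg with hL
  rw [Option.some.injEq] at hg
  obtain ⟨U, V, hUV⟩ := exists_blocksWord_eq f hj hjn
  have hred : IsReducedWordFor w (U ++ (f (j + 1) ++ f j) ++ V) := by
    rw [← hUV f fun _ _ _ => rfl, ← factWord_eq_blocksWord hf.2.1]
    exact hf.2.2.2
  have ha := foldr_max_mem hL
  have hmax := fun x hx => le_foldr_max (L := unpairedUpper (f j).reverse (f (j + 1))) (x := x) hx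
  have hs' := sInf_gap_notMem (f (j + 1)) ((unpairedUpper (f j).reverse (f (j + 1))).foldr max 0)
  generalize (unpairedUpper (f j).reverse (f (j + 1))).foldr max 0 = a at *
  have hs : ∀ k < sInf {k : ℕ | a + k + 1 ∉ f (j + 1)}, a + k + 1 ∈ f (j + 1) := fun k hk => by
    simpa using Nat.notMem_of_lt_sInf hk
  generalize sInf {k : ℕ | a + k + 1 ∉ f (j + 1)} = s at *
  obtain ⟨haA, hnot, hor, hw⟩ := raise_blocks (pairwise_of_mem_RFn hf _) (pairwise_of_mem_RFn hf _)
    (isReducedWord_of_append hred.1) ha hmax hs hs'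
  have gj : g j = insAsc (a + s) (f j) := by simp [← hg]
  have gj1 : g (j + 1) = (f (j + 1)).erase a := by simp [← hg]
  have gm : ∀ m, m ≠ j → m ≠ j + 1 → g m = f m := by
    intro m h1 h2
    simp [← hg, h1, h2]
  refine ⟨⟨?_, ?_, ?_, ?_⟩, gm, a, s, haA, ?_, gj1, gj⟩
  · rw [gm 0 (by omega) (by omega), hf.1]
  · intro m hm
    rw [gm m (by omega) (by omega), hf.2.1 m hm]
  · intro m
    refine List.isChain_iff_pairwise.2 ?_
    by_cases h1 : m = j
    · rw [h1, gj]
      exact pairwise_insAsc (pairwise_of_mem_RFn hf _) hnot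
    · by_cases h2 : m = j + 1
      · rw [h2, gj1]
        exact (pairwise_of_mem_RFn hf _).sublist List.erase_sublist
      · rw [gm m h1 h2]
        exact pairwise_of_mem_RFn hf _
  · rw [factWord_eq_blocksWord (N := n) fun m hm => by
      rw [gm m (by omega) (by omega), hf.2.1 m hm], hUV g gm]
    refine isReducedWordFor_replace hred ?_ (by rw [gj, gj1, hw]) ?_
    · intro x hx
      rw [gj, gj1, List.mem_append, mem_insAsc] at hx
      rcases hx with hx | rfl | hx
      · exact pos_of_mem_of_mem_RFn hf (List.mem_of_mem_erase hx)
      · have := pos_of_mem_of_mem_RFn hf haA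
        omega
      · exact pos_of_mem_of_mem_RFn hf hx
    · have := List.length_pos_of_mem haA
      rw [gj, gj1, List.length_append, List.length_append, length_insAsc,
        List.length_erase_of_mem haA]
      omega
  · rw [gj, mem_insAsc]
    rcases hor with rfl | h
    · exact Or.inl (add_zero a).symm
    · exact Or.inr h

theorem lt_of_msE_eq_none {f : ℕ → List ℕ} {i j : ℕ}
    (hn : msE j f = none) (hi : ∀ x ∈ f j, i ≤ x) : ∀ x ∈ f (j + 1), i < x := by
  simp only [msE] at hn
  split_ifs at hn with hL
  intro x hx
  obtain ⟨b, hb, hbx⟩ := exists_lt_of_notMem_unpairedUpper hx (by rw [hL]; simp)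
  exact (hi b (by simpa using hb)).trans_lt hbx

/-! ### Demazure operators and flags -/

/-- The factorizations in `RF_n(w)` all of whose letters `x` in block `m` satisfy `m ≤ φ x`. -/
def boundedFacts (n : ℕ) (w : Equiv.Perm ℕ) (φ : ℕ → ℕ) : Set (ℕ → List ℕ) :=
  {f | f ∈ RFn n w ∧ ∀ m, ∀ x ∈ f m, m ≤ φ x}

theorem RFCn_eq_boundedFacts {n : ℕ} {w : Equiv.Perm ℕ} {φ : ℕ → ℕ}
    (hφ : ∀ m n : ℕ, 1 ≤ m → m ≤ n → φ m ≤ φ n) : RFCn n w φ = boundedFacts n w φ := by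
  ext f
  refine and_congr_right fun hf => forall_congr' fun m => ?_
  have hp := pairwise_of_mem_RFn hf m
  have hpos := fun x (hx : x ∈ f m) => pos_of_mem_of_mem_RFn hf hx
  generalize f m = u at *
  cases u with
  | nil => simp
  | cons y u =>
    simp only [ne_eq, reduceCtorEq, not_false_eq_true, forall_true_left, List.headI_cons]
    refine ⟨fun h x hx => h.trans (hφ _ _ (hpos y (by simp)) ?_), fun h => h y (by simp)⟩
    rcases List.mem_cons.1 hx with rfl | hx
    · exact le_rfl
    · exact ((List.pairwise_cons.1 hp).1 x hx).le

theorem boundedFacts_congr {n : ℕ} {w : Equiv.Perm ℕ} {φ ψ : ℕ → ℕ}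
    (h : ∀ x, 1 ≤ x → min n (φ x) = min n (ψ x)) :
    boundedFacts n w φ = boundedFacts n w ψ := by
  ext f
  refine and_congr_right fun hf => forall_congr' fun m => forall₂_congr fun x hx => ?_
  have h1 := h x (pos_of_mem_of_mem_RFn hf hx)
  have h2 := le_of_mem_of_mem_RFn hf hx
  omega

theorem demOp_boundedFacts {n : ℕ} (w : Equiv.Perm ℕ) {φ : ℕ → ℕ} {i j : ℕ} (hj : 1 ≤ j)
    (hjn : j < n) (hi : φ i = j) (hlt : ∀ m, 1 ≤ m → m < i → φ m < j)
    (hgt : ∀ m, i < m → j < φ m) :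
    demOp n w j (boundedFacts n w φ) = boundedFacts n w (Function.update φ i (j + 1)) := by
  have hle1 : ∀ x, 1 ≤ x → (j ≤ φ x ↔ i ≤ x) := by
    intro x hx
    have h1 := hlt x hx
    have h2 := hgt x
    rcases lt_trichotomy x i with h | h | h
    · simp only [h, forall_true_left] at h1; omega
    · subst h; omega
    · simp only [h, forall_true_left] at h2; omega
  have hle2 : ∀ x, 1 ≤ x → (j + 1 ≤ φ x ↔ i < x) := by
    intro x hx
    have h1 := hlt x hx
    have h2 := hgt x
    rcases lt_trichotomy x i with h | h | h
    · simp only [h, forall_true_left] at h1; omega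
    · subst h; omega
    · simp only [h, forall_true_left] at h2; omega
  have hφ : ∀ f, f ∈ boundedFacts n w φ ↔ f ∈ RFn n w ∧ (∀ x ∈ f j, i ≤ x) ∧
      (∀ x ∈ f (j + 1), i < x) ∧ ∀ m, m ≠ j → m ≠ j + 1 → ∀ x ∈ f m, m ≤ φ x := by
    intro f
    refine and_congr_right fun hf => ⟨fun h => ⟨?_, ?_, fun m _ _ => h m⟩, ?_⟩
    · exact fun x hx => (hle1 x (pos_of_mem_of_mem_RFn hf hx)).1 (h j x hx)
    · exact fun x hx => (hle2 x (pos_of_mem_of_mem_RFn hf hx)).1 (h _ x hx)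
    · rintro ⟨h1, h2, h3⟩ m x hx
      by_cases hm : m = j
      · subst hm
        exact (hle1 x (pos_of_mem_of_mem_RFn hf hx)).2 (h1 x hx)
      · by_cases hm' : m = j + 1
        · subst hm'
          exact (hle2 x (pos_of_mem_of_mem_RFn hf hx)).2 (h2 x hx)
        · exact h3 m hm hm' x hx
  have hψ : ∀ f, f ∈ boundedFacts n w (Function.update φ i (j + 1)) ↔
      f ∈ RFn n w ∧ (∀ x ∈ f j, i ≤ x) ∧
      (∀ x ∈ f (j + 1), i ≤ x) ∧ ∀ m, m ≠ j → m ≠ j + 1 → ∀ x ∈ f m, m ≤ φ x := by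
    intro f
    have hup : ∀ x m, m ≤ Function.update φ i (j + 1) x ↔ m ≤ φ x ∨ (x = i ∧ m = j + 1) := by
      intro x m
      by_cases hx : x = i
      · subst hx
        simp only [Function.update_self, hi, true_and]
        omega
      · simp [hx]
    refine and_congr_right fun hf => ?_
    simp only [hup]
    constructor
    · refine fun h => ⟨fun x hx => ?_, fun x hx => ?_, fun m h1 h2 x hx => ?_⟩
      · rcases h j x hx with h | h
        · exact (hle1 x (pos_of_mem_of_mem_RFn hf hx)).1 h
        · omega
      · rcases h _ x hx with h | h
        · exact ((hle2 x (pos_of_mem_of_mem_RFn hf hx)).1 h).le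
        · omega
      · rcases h m x hx with h | h
        · exact h
        · omega
    · rintro ⟨h1, h2, h3⟩ m x hx
      by_cases hm : m = j
      · subst hm
        exact Or.inl ((hle1 x (pos_of_mem_of_mem_RFn hf hx)).2 (h1 x hx))
      · by_cases hm' : m = j + 1
        · subst hm'
          rcases Nat.eq_or_lt_of_le (h2 x hx) with h | h
          · exact Or.inr ⟨h.symm, rfl⟩
          · exact Or.inl ((hle2 x (pos_of_mem_of_mem_RFn hf hx)).2 h)
        · exact Or.inl (h3 m hm hm' x hx)
  apply Set.Subset.antisymm
  · rintro f ⟨hf, k, c, hk, hc⟩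
    induction k generalizing f with
    | zero =>
      rw [msEIter, Option.some.injEq] at hk
      subst hk
      obtain ⟨h0, h1, h2, h3⟩ := (hφ _).1 hc
      exact (hψ _).2 ⟨h0, h1, fun x hx => (h2 x hx).le, h3⟩
    | succ k ih =>
      rw [msEIter, Option.bind_eq_some_iff] at hk
      obtain ⟨g, hg, hk⟩ := hk
      obtain ⟨hgR, hgm, a, s, -, hag, hg1, hg0⟩ := msE_spec hf hj hjn hg
      obtain ⟨-, h1, h2, h3⟩ := (hψ _).1 (ih hgR hk)
      refine (hψ _).2 ⟨hf, fun x hx => h1 x ?_, fun x hx => ?_, fun m hm hm' => ?_⟩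
      · rw [hg0]
        exact mem_insAsc.2 (Or.inr hx)
      · by_cases hxa : x = a
        · rw [hxa]
          exact h1 a hag
        · refine h2 x ?_
          rw [hg1]
          exact (List.mem_erase_of_ne hxa).2 hx
      · rw [← hgm m hm hm']
        exact h3 m hm hm'
  · intro f hf
    refine ⟨hf.1, ?_⟩
    induction hN : (f (j + 1)).length using Nat.strong_induction_on generalizing f with
    | _ N ih =>
      obtain ⟨hR, h1, h2, h3⟩ := (hψ _).1 hf
      cases hg : msE j f with
      | none =>
        exact ⟨0, f, rfl, (hφ _).2 ⟨hR, h1, lt_of_msE_eq_none hg h1, h3⟩⟩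
      | some g =>
        obtain ⟨hgR, hgm, a, s, haf, -, hg1, hg0⟩ := msE_spec hR hj hjn hg
        have hlen : (g (j + 1)).length < N := by
          have := List.length_pos_of_mem haf
          rw [hg1, List.length_erase_of_mem haf]
          omega
        have hgψ : g ∈ boundedFacts n w (Function.update φ i (j + 1)) := by
          refine (hψ _).2 ⟨hgR, fun x hx => ?_, fun x hx => ?_, fun m hm hm' => ?_⟩
          · rw [hg0, mem_insAsc] at hx
            rcases hx with rfl | hx
            · exact (h2 a haf).trans (Nat.le_add_right _ _)
            · exact h1 x hx
          · rw [hg1] at hx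
            exact h2 x (List.mem_of_mem_erase hx)
          · rw [hgm m hm hm']
            exact h3 m hm hm'
        obtain ⟨k, c, hk, hc⟩ := ih _ hlen hgψ rfl
        exact ⟨k + 1, c, by simp [msEIter, hg, hk], hc⟩

theorem demDown_boundedFacts {n : ℕ} (w : Equiv.Perm ℕ) {φ : ℕ → ℕ} {i t : ℕ} (h1 : 1 ≤ i)
    (hit : i ≤ t) (htn : t ≤ n) (hi : φ i = i) (hlt : ∀ m, 1 ≤ m → m < i → φ m < i)
    (hgt : ∀ m, i < m → t ≤ φ m) :
    demDown n w t i (boundedFacts n w φ) = boundedFacts n w (Function.update φ i t) := by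
  induction t, hit using Nat.le_induction with
  | base =>
    rw [← congrArg (Function.update φ i) hi, Function.update_eq_self]
    simp [demDown, demWord]
  | succ t hit ih =>
    have ih' := ih (by omega) fun m hm => (Nat.le_succ t).trans (hgt m hm)
    rw [demDown] at ih' ⊢
    rw [Nat.succ_sub hit, List.range'_concat, List.reverse_append, List.reverse_singleton,
      List.singleton_append, demWord, ih', one_mul, Nat.add_sub_cancel' hit,
      demOp_boundedFacts w (by omega) (by omega) (Function.update_self _ _ _)]
    · simp
    · intro m hm hmi
      rw [Function.update_of_ne hmi.ne]
      exact (hlt m hm hmi).trans_le hit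
    · intro m hmi
      rw [Function.update_of_ne hmi.ne']
      exact hgt m hmi

/-- Corollary `corollary 4.5`.
With `t_i = min {n, φ(i)}` for `1 ≤ i ≤ n`, we have
`RFC_n(w, φ) = 𝔇_{t_1↓1} 𝔇_{t_2↓2} ⋯ 𝔇_{t_n↓n} RFC_n(w)`, where `RFC_n(w)` uses the
standard flag `φ(i) = i`. -/
theorem RFCn_eq_demazure_chain (w : Equiv.Perm ℕ) (hw : FinitaryPerm w) (n : ℕ)
    (hn : 1 ≤ n) (φ : ℕ → ℕ) (hφ : IsFlag φ) :
    RFCn n w φ =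
      (List.range' 1 n).foldr (fun i X => demDown n w (min n (φ i)) i X)
        (RFCn n w (fun m => m)) := by
  have key : ∀ k ≤ n, (List.range' (n + 1 - k) k).foldr
      (fun i X => demDown n w (min n (φ i)) i X) (RFCn n w (fun m => m)) =
      boundedFacts n w (fun m => if m < n + 1 - k then m else min n (φ m)) := by
    intro k hk
    induction k with
    | zero =>
      rw [List.range'_zero, List.foldr_nil, RFCn_eq_boundedFacts fun _ _ _ h => h]
      refine boundedFacts_congr fun x hx => ?_
      have := hφ.2 x hx
      split_ifs <;> omega
    | succ k ih =>
      have e : n + 1 - (k + 1) + 1 = n + 1 - k := by omega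
      have hpos : 1 ≤ n + 1 - (k + 1) := by omega
      rw [List.range'_succ, List.foldr_cons, e, ih (by omega)]
      rw [← e]
      have hin : n + 1 - (k + 1) ≤ n := by omega
      generalize n + 1 - (k + 1) = i at *
      have hφi := hφ.2 i hpos
      rw [demDown_boundedFacts w hpos (le_min hin hφi) (min_le_left _ _)]
      · congr 1
        ext m
        by_cases hm : m = i
        · subst hm
          simp
        · rw [Function.update_of_ne hm]
          split_ifs <;> omega
      · simp
      · intro m _ hm
        rw [if_pos (by omega)]
        exact hm
      · intro m hm
        rw [if_neg (by omega)]
        exact min_le_min_left _ (hφ.1 i m hpos hm.le)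
  have h := key n le_rfl
  rw [Nat.add_sub_cancel_left] at h
  rw [h, RFCn_eq_boundedFacts hφ.1]
  refine boundedFacts_congr fun x hx => ?_
  rw [if_neg (by omega)]
  omega

end
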